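/- Fix y ∈ ℝ³ and fixed vectors ν, f ∈ ℝ³. Define the vector field F on ℝ³∖{y} by F(x) := [ ν((x−y)·f) − (x−y)(ν·f) − ((x−y)·ν) f ] / |x−y|³. Then each component of F is a harmonic function on ℝ³∖{y} and ∇·F = 0 on ℝ³∖{y}. -/

import Mathlib

noncomputable section

open scoped BigOperators

/-- Points of `ℝ³`. -/
abbrev V3 : Type := Fin 3 → ℝ

/-- The Euclidean inner product on `ℝ³`. -/
def dot3 (x y : V3) : ℝ := ∑ i, x i * y i

/-- The Euclidean norm on `ℝ³`. -/
def norm3 (x : V3) : ℝ := Real.sqrt (dot3 x x)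

/-- The cross product on `ℝ³` (cyclic formula, `(x × y) i = x (i+1) y (i+2) - x (i+2) y (i+1)`). -/
def cross3 (x y : V3) : V3 := fun i => x (i + 1) * y (i + 2) - x (i + 2) * y (i + 1)

/-- Partial derivative in the `i`-th coordinate direction. -/
def pd (i : Fin 3) (f : V3 → ℝ) (x : V3) : ℝ := fderiv ℝ f x (Pi.single i 1)

/-- Gradient of a scalar field. -/
def grad3 (f : V3 → ℝ) (x : V3) : V3 := fun i => pd i f x

/-- Divergence of a vector field. -/
def div3 (p : V3 → V3) (x : V3) : ℝ := ∑ i, pd i (fun y => p y i) x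

/-- Curl of a vector field. -/
def curl3 (p : V3 → V3) (x : V3) : V3 :=
  fun i => pd (i + 1) (fun y => p y (i + 2)) x - pd (i + 2) (fun y => p y (i + 1)) x

/-- `f` is the function of a homogeneous polynomial of degree `k` on `ℝ³`. -/
def IsHomogPoly (k : ℕ) (f : V3 → ℝ) : Prop :=
  ∃ q : MvPolynomial (Fin 3) ℝ, q.IsHomogeneous k ∧ ∀ x, f x = MvPolynomial.eval x q

/-- `f` is harmonic (its Laplacian vanishes) on all of `ℝ³`. -/
def IsHarmonic (f : V3 → ℝ) : Prop := ∀ x, ∑ i, pd i (pd i f) x = 0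

/-- `P_k`: homogeneous harmonic polynomials of degree `k` (as functions on `ℝ³`). -/
def Pk (k : ℕ) : Set (V3 → ℝ) := {f | IsHomogPoly k f ∧ IsHarmonic f}

/-- `P_k³`: vector fields all of whose components lie in `P_k`. -/
def Pk3 (k : ℕ) : Set (V3 → V3) := {p | ∀ i, (fun x => p x i) ∈ Pk k}

/-- Kelvin transform of a degree-`k` homogeneous field: `p*(x) = |x|^{-(2k+1)} p(x)`. -/
def kelvin (k : ℕ) (p : V3 → V3) : V3 → V3 := fun x => (norm3 x ^ (2 * k + 1))⁻¹ • p x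

/-- `W_k^o`: fields in `P_k³` that are divergence free on `ℝ³` and whose Kelvin transform
is divergence free on `ℝ³ \ {0}`. -/
def Wko (k : ℕ) : Set (V3 → V3) :=
  {p | p ∈ Pk3 k ∧ (∀ x, div3 p x = 0) ∧ ∀ x : V3, x ≠ 0 → div3 (kelvin k p) x = 0}

/-- `W_k^-`: fields in `P_k³` that are divergence free and curl free on `ℝ³`. -/
def Wkm (k : ℕ) : Set (V3 → V3) :=
  {p | p ∈ Pk3 k ∧ (∀ x, div3 p x = 0) ∧ ∀ x, curl3 p x = 0}

/-- `W_k^+`: fields in `P_k³` whose Kelvin transform is divergence free and curl free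
on `ℝ³ \ {0}`. -/
def Wkp (k : ℕ) : Set (V3 → V3) :=
  {p | p ∈ Pk3 k ∧ (∀ x : V3, x ≠ 0 → div3 (kelvin k p) x = 0) ∧
    ∀ x : V3, x ≠ 0 → curl3 (kelvin k p) x = 0}

/-- The (un-normalized) kernel field of the div-free elastic double layer potential:
`F(x) = [ν((x−y)·f) − (x−y)(ν·f) − ((x−y)·ν)f] / |x−y|³`. -/
def dlKernelField (y ν f : V3) : V3 → V3 := fun x =>
  (norm3 (x - y) ^ 3)⁻¹ •
    (dot3 (x - y) f • ν - dot3 ν f • (x - y) - dot3 (x - y) ν • f)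

lemma dot3_self_pos {x : V3} (hx : x ≠ 0) : 0 < dot3 x x := by
  obtain ⟨i, hi⟩ := Function.ne_iff.mp hx
  exact Finset.sum_pos' (fun j _ => mul_self_nonneg (x j))
    ⟨i, Finset.mem_univ i, mul_self_pos.mpr hi⟩

lemma norm3_pos {x : V3} (hx : x ≠ 0) : 0 < norm3 x :=
  Real.sqrt_pos.mpr (dot3_self_pos hx)

lemma norm3_sq (x : V3) : norm3 x ^ 2 = dot3 x x :=
  Real.sq_sqrt (Finset.sum_nonneg fun j _ => mul_self_nonneg (x j))

lemma hasFDerivAt_apply_sub (y x : V3) (i : Fin 3) :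
    HasFDerivAt (fun z : V3 => z i - y i) (ContinuousLinearMap.proj (R := ℝ) i) x :=
  (hasFDerivAt_apply i x).sub_const (y i)

lemma pd_apply_sub (y x : V3) (i j : Fin 3) :
    pd i (fun z : V3 => z j - y j) x = if j = i then 1 else 0 := by
  rw [pd, (hasFDerivAt_apply_sub y x j).fderiv]
  simp [Pi.single_apply]

lemma hasFDerivAt_dot3_sub (y a x : V3) :
    HasFDerivAt (fun z : V3 => dot3 (z - y) a)
      (∑ i, a i • ContinuousLinearMap.proj (R := ℝ) (φ := fun _ : Fin 3 => ℝ) i) x :=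
  HasFDerivAt.fun_sum fun i _ => (hasFDerivAt_apply_sub y x i).mul_const (a i)

lemma pd_dot3_sub (y a x : V3) (i : Fin 3) :
    pd i (fun z : V3 => dot3 (z - y) a) x = a i := by
  rw [pd, (hasFDerivAt_dot3_sub y a x).fderiv]
  simp [Pi.single_apply]

lemma hasFDerivAt_dot3_sub_self (y x : V3) :
    HasFDerivAt (fun z : V3 => dot3 (z - y) (z - y))
      (∑ i, (2 * (x i - y i)) •
        ContinuousLinearMap.proj (R := ℝ) (φ := fun _ : Fin 3 => ℝ) i) x := by
  refine HasFDerivAt.fun_sum fun i _ => ?_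
  exact ((hasFDerivAt_apply_sub y x i).fun_mul (hasFDerivAt_apply_sub y x i)).congr_fderiv
    (by rw [two_mul, add_smul])

lemma hasFDerivAt_inv_norm3_pow (k : ℕ) {y x : V3} (hx : x ≠ y) :
    HasFDerivAt (fun z : V3 => (norm3 (z - y) ^ k)⁻¹)
      (∑ i, (-(k * (x i - y i) * (norm3 (x - y) ^ (k + 2))⁻¹)) •
        ContinuousLinearMap.proj (R := ℝ) (φ := fun _ : Fin 3 => ℝ) i) x := by
  have hr : norm3 (x - y) ≠ 0 := (norm3_pos (sub_ne_zero.mpr hx)).ne'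
  have hd : dot3 (x - y) (x - y) ≠ 0 := (dot3_self_pos (sub_ne_zero.mpr hx)).ne'
  have h := (hasDerivAt_inv (pow_ne_zero k hr)).comp_hasFDerivAt x
    (((hasFDerivAt_dot3_sub_self y x).sqrt hd).pow k)
  refine h.congr_fderiv ?_
  simp only [Finset.smul_sum, smul_smul]
  refine Finset.sum_congr rfl fun i _ => ?_
  congr 1
  change _ * ((k • norm3 (x - y) ^ (k - 1)) * (1 / (2 * norm3 (x - y)) * _)) = _
  rcases k with _ | k
  · simp
  · simp only [Nat.add_sub_cancel, nsmul_eq_mul]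
    field_simp
    ring

lemma differentiableAt_inv_norm3_pow_mul (k : ℕ) {y x : V3} (hx : x ≠ y) {p : V3 → ℝ}
    (hp : DifferentiableAt ℝ p x) :
    DifferentiableAt ℝ (fun z => (norm3 (z - y) ^ k)⁻¹ * p z) x :=
  (hasFDerivAt_inv_norm3_pow k hx).differentiableAt.mul hp

lemma pd_mul (i : Fin 3) {p q : V3 → ℝ} {x : V3} (hp : DifferentiableAt ℝ p x)
    (hq : DifferentiableAt ℝ q x) :
    pd i (fun z => p z * q z) x = p x * pd i q x + q x * pd i p x := by
  simp [pd, fderiv_fun_mul hp hq]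

lemma pd_inv_norm3_pow_mul (k : ℕ) (i : Fin 3) {y x : V3} (hx : x ≠ y) {p : V3 → ℝ}
    (hp : DifferentiableAt ℝ p x) :
    pd i (fun z => (norm3 (z - y) ^ k)⁻¹ * p z) x =
      (norm3 (x - y) ^ k)⁻¹ * pd i p x -
        (norm3 (x - y) ^ (k + 2))⁻¹ * (k * ((x i - y i) * p x)) := by
  have h := hasFDerivAt_inv_norm3_pow k hx
  rw [pd_mul i h.differentiableAt hp, pd.eq_1 i (fun z => (norm3 (z - y) ^ k)⁻¹), h.fderiv]
  simp [Pi.single_apply]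
  ring

/-- The dipole field `x ↦ ((x - y) · a) / |x - y|³` is harmonic away from `y`. -/
lemma sum_pd_pd_inv_norm3_pow_three_mul_dot3 (y a : V3) {x : V3} (hx : x ≠ y) :
    ∑ i, pd i (pd i (fun z => (norm3 (z - y) ^ 3)⁻¹ * dot3 (z - y) a)) x = 0 := by
  have hl (z : V3) : DifferentiableAt ℝ (fun z : V3 => dot3 (z - y) a) z :=
    (hasFDerivAt_dot3_sub y a z).differentiableAt
  have hc (i : Fin 3) : DifferentiableAt ℝ (fun z : V3 => z i - y i) x :=
    (hasFDerivAt_apply_sub y x i).differentiableAt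
  have second (i : Fin 3) :
      pd i (pd i (fun z => (norm3 (z - y) ^ 3)⁻¹ * dot3 (z - y) a)) x =
        15 * (norm3 (x - y) ^ 7)⁻¹ * ((x i - y i) * (x i - y i)) * dot3 (x - y) a
        - 6 * (norm3 (x - y) ^ 5)⁻¹ * ((x i - y i) * a i)
        - 3 * (norm3 (x - y) ^ 5)⁻¹ * dot3 (x - y) a := by
    have first : pd i (fun z => (norm3 (z - y) ^ 3)⁻¹ * dot3 (z - y) a) =ᶠ[nhds x]
        fun z => (norm3 (z - y) ^ 3)⁻¹ * a i -
          (norm3 (z - y) ^ 5)⁻¹ * (3 * ((z i - y i) * dot3 (z - y) a)) := by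
      filter_upwards [isOpen_ne.mem_nhds hx] with z hz
      rw [pd_inv_norm3_pow_mul 3 i hz (hl z), pd_dot3_sub]
      norm_num
    have hq : DifferentiableAt ℝ (fun z : V3 => 3 * ((z i - y i) * dot3 (z - y) a)) x :=
      ((hc i).fun_mul (hl x)).const_mul 3
    have ha : DifferentiableAt ℝ (fun _ : V3 => a i) x := differentiableAt_const _
    rw [pd, first.fderiv_eq,
      fderiv_fun_sub (differentiableAt_inv_norm3_pow_mul 3 hx ha)
        (differentiableAt_inv_norm3_pow_mul 5 hx hq), sub_apply]
    change pd i _ x - pd i _ x = _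
    rw [pd_inv_norm3_pow_mul 3 i hx ha, pd_inv_norm3_pow_mul 5 i hx hq,
      pd_mul i (differentiableAt_const _) ((hc i).fun_mul (hl x)), pd_mul i (hc i) (hl x),
      pd_apply_sub, pd_dot3_sub]
    simp [pd]
    ring
  have hr : norm3 (x - y) ≠ 0 := (norm3_pos (sub_ne_zero.mpr hx)).ne'
  have hs : ∑ i, (x i - y i) * (x i - y i) = norm3 (x - y) ^ 2 := (norm3_sq _).symm
  have ht : ∑ i, (x i - y i) * a i = dot3 (x - y) a := rfl
  simp only [second, Finset.sum_sub_distrib, ← Finset.mul_sum, ← Finset.sum_mul, hs, ht,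
    Finset.sum_const, Finset.card_univ, Fintype.card_fin, nsmul_eq_mul]
  field_simp
  norm_num

lemma dlKernelField_apply (y ν f z : V3) (j : Fin 3) :
    dlKernelField y ν f z j = (norm3 (z - y) ^ 3)⁻¹ *
      dot3 (z - y) (ν j • f - dot3 ν f • Pi.single j 1 - f j • ν) := by
  have h : dot3 (z - y) (ν j • f - dot3 ν f • Pi.single j 1 - f j • ν) =
      ν j * dot3 (z - y) f - dot3 ν f * (z j - y j) - f j * dot3 (z - y) ν := by
    fin_cases j <;> simp [dot3, Fin.sum_univ_three, Pi.single_apply] <;> ring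
  rw [h]
  simp only [dlKernelField, Pi.smul_apply, Pi.sub_apply, smul_eq_mul]
  ring

/-- For fixed `y, ν, f ∈ ℝ³`, every component of the field
`F(x) = [ν((x−y)·f) − (x−y)(ν·f) − ((x−y)·ν)f]/|x−y|³` is harmonic on `ℝ³ \ {y}` and
`∇·F = 0` on `ℝ³ \ {y}`. -/
theorem dlKernelField_harmonic_div_free (y ν f : V3) :
    (∀ j : Fin 3, ∀ x : V3, x ≠ y →
      ∑ i, pd i (pd i (fun z => dlKernelField y ν f z j)) x = 0) ∧
    (∀ x : V3, x ≠ y → div3 (dlKernelField y ν f) x = 0) := by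
  simp only [div3, dlKernelField_apply]
  refine ⟨fun j x hx => sum_pd_pd_inv_norm3_pow_three_mul_dot3 y _ hx, fun x hx => ?_⟩
  have hr : norm3 (x - y) ≠ 0 := (norm3_pos (sub_ne_zero.mpr hx)).ne'
  have hs : (norm3 (x - y) ^ 3)⁻¹ = dot3 (x - y) (x - y) * (norm3 (x - y) ^ (3 + 2))⁻¹ := by
    rw [← norm3_sq]
    field_simp
  simp only [pd_inv_norm3_pow_mul 3 _ hx (hasFDerivAt_dot3_sub y _ x).differentiableAt,
    pd_dot3_sub, hs]
  simp [dot3, Fin.sum_univ_three, Pi.single_apply]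
  ring
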